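/- Let q be a prime power, let n, k, δ be integers with 1 < k ≤ n−k and 1 ≤ δ ≤ k−1, let 𝒞 be a [k×(n−k), (n−k)(k−δ+1), δ]_q MRD code, and let C^MRD be its lifted code. Let A and B be distinct one-dimensional subspaces of 𝔽_q^k, and let X₁ ∈ V_A^{(n,k)} and X₂ ∈ V_B^{(n,k)}. Then X₁ and X₂ are simultaneously contained in exactly q^{(n−k)(k−δ−1)} codewords of C^MRD. -/

import Mathlib

open Module Polynomial Matrix

variable (F : Type) [Field F] [Fintype F]

/-- `C` is a `[k × (n-k), (n-k)(k-δ+1), δ]_q` MRD (maximum rank distance) code: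
an `F`-linear subspace of `k × (n-k)` matrices of dimension `(n-k)(k-δ+1)` in which
every nonzero matrix has rank at least `δ`. -/
def IsMRD (n k δ : ℕ) (C : Submodule F (Matrix (Fin k) (Fin (n - k)) F)) : Prop :=
  Module.finrank F C = (n - k) * (k - δ + 1) ∧
    ∀ A : Matrix (Fin k) (Fin (n - k)) F, A ∈ C → A ≠ 0 → δ ≤ A.rank

/-- The matrix `[I_k | A]`. -/
def liftMatrix (n k : ℕ) (A : Matrix (Fin k) (Fin (n - k)) F) : Matrix (Fin k) (Fin n) F :=
  Matrix.of fun i j =>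
    if h : (j : ℕ) < k then (if (i : ℕ) = (j : ℕ) then 1 else 0)
    else A i ⟨(j : ℕ) - k, by have := j.isLt; omega⟩

/-- The lifting of the matrix `A`: the row space of `[I_k | A]`, a subspace of `F^n`. -/
def liftSubspace (n k : ℕ) (A : Matrix (Fin k) (Fin (n - k)) F) : Submodule F (Fin n → F) :=
  Submodule.span F (Set.range fun i => liftMatrix F n k A i)

/-- The lifted code of a rank-metric code `C`: the set of liftings of all codewords of `C`. -/
def liftedCode (n k : ℕ) (C : Submodule F (Matrix (Fin k) (Fin (n - k)) F)) :
    Set (Submodule F (Fin n → F)) :=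
  {X | ∃ A ∈ C, X = liftSubspace F n k A}

/-- The subspace distance `d_S(X,Y) = dim X + dim Y - 2 dim (X ⊓ Y)`. -/
noncomputable def subDist {n : ℕ} (X Y : Submodule F (Fin n → F)) : ℕ :=
  finrank F X + finrank F Y - 2 * finrank F (X ⊓ Y : Submodule F (Fin n → F))

/-- `L^{(n,k)}`: vectors of `F^n` whose first `k` coordinates are not all zero. -/
def Lset (n k : ℕ) : Set (Fin n → F) := {v | ∃ i : Fin n, (i : ℕ) < k ∧ v i ≠ 0}

/-- `V^n`: one-dimensional subspaces of `F^n` spanned by vectors of `L^{(n,k)}`. -/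
def Vset (n k : ℕ) : Set (Submodule F (Fin n → F)) :=
  {X | ∃ v ∈ Lset F n k, X = Submodule.span F {v}}

/-- Projection of a vector of `F^n` onto its first `k` coordinates. -/
def projK (n k : ℕ) (v : Fin n → F) : Fin k → F :=
  fun i => if h : (i : ℕ) < n then v ⟨(i : ℕ), h⟩ else 0

/-- `V_A^{(n,k)}`: one-dimensional subspaces of `F^n` spanned by vectors whose projection
onto the first `k` coordinates is a nonzero vector spanning `A`. -/
def VA (n k : ℕ) (A : Submodule F (Fin k → F)) : Set (Submodule F (Fin n → F)) :=
  {X | ∃ v : Fin n → F, projK F n k v ≠ 0 ∧ Submodule.span F {projK F n k v} = A ∧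
    X = Submodule.span F {v}}

/-- `A_q(n,d,k)`: the maximum size of an `(n, M, d, k)_q` constant dimension code, i.e. of a
set of `k`-dimensional subspaces of `F^n` whose pairwise subspace distances are at least `d`. -/
noncomputable def Aq (n d k : ℕ) : ℕ :=
  sSup {M | ∃ S : Set (Submodule F (Fin n → F)), S.Finite ∧ S.ncard = M ∧
    (∀ X ∈ S, finrank F X = k) ∧ ∀ X ∈ S, ∀ Y ∈ S, X ≠ Y → d ≤ subDist F X Y}

/-- The Gaussian coefficient `[n, k]_q`: the number of `k`-dimensional subspaces of `F^n`. -/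
noncomputable def gaussNat (n k : ℕ) : ℕ :=
  Nat.card {X : Submodule F (Fin n → F) // finrank F X = k}

/-- The linear map sending a matrix of the code `C` to its products with the row vectors `v i`. -/
def vecMulFamily {K ι κ τ : Type*} [Field K] [Fintype ι] (C : Submodule K (Matrix ι κ K))
    (v : τ → ι → K) : C →ₗ[K] (τ → κ → K) where
  toFun A := fun i => v i ᵥ* (A : Matrix ι κ K)
  map_add' A B := by ext1 i; simp [Matrix.vecMul_add]
  map_smul' c A := by ext1 i; simp [Matrix.vecMul_smul]

/-- Linearly independent vectors in the left kernel of a matrix bound its rank. -/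
theorem card_add_rank_le_of_vecMul_eq_zero {K ι κ : Type*} [Field K] [Fintype ι] [Fintype κ]
    {r : ℕ} {v : Fin r → ι → K} (hv : LinearIndependent K v) {A : Matrix ι κ K}
    (h : ∀ i, v i ᵥ* A = 0) : r + A.rank ≤ Fintype.card ι := by
  classical
  have hker : Submodule.span K (Set.range v) ≤ LinearMap.ker A.vecMulLinear := by
    rw [Submodule.span_le]
    rintro _ ⟨i, rfl⟩
    exact h i
  have h₁ := Submodule.finrank_mono hker
  have h₂ := A.vecMulLinear.finrank_range_add_finrank_ker
  rw [finrank_span_eq_card hv, Fintype.card_fin] at h₁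
  rw [_root_.range_vecMulLinear, ← Matrix.rank_eq_finrank_span_row,
    Module.finrank_fintype_fun_eq_card] at h₂
  omega

/-- A code attaining the Singleton-like bound takes arbitrary values on few linearly independent
row vectors. -/
theorem vecMulFamily_surjective {K ι κ : Type*} [Field K] [Fintype ι] [Fintype κ] {δ s : ℕ}
    {C : Submodule K (Matrix ι κ K)} (hs : s ≤ Fintype.card ι) (hδ : Fintype.card ι < s + δ)
    (hdim : finrank K C = Fintype.card κ * s) (hC : ∀ A ∈ C, A ≠ 0 → δ ≤ A.rank)
    {r : ℕ} (hr : r ≤ s) (v : Fin r → ι → K) (hv : LinearIndependent K v) :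
    Function.Surjective (vecMulFamily C v) := by
  induction hr using Nat.decreasingInduction with
  | self =>
    rw [← LinearMap.injective_iff_surjective_of_finrank_eq_finrank
      (by simp [hdim, Module.finrank_pi_fintype, mul_comm]), injective_iff_map_eq_zero]
    intro A hA
    by_contra hne
    have := card_add_rank_le_of_vecMul_eq_zero hv (A := A.1) fun i => congrFun hA i
    have := hC A A.2 (by simpa using hne)
    omega
  | of_succ r hr ih =>
    obtain ⟨x, hx⟩ := exists_linearIndependent_snoc_of_lt_finrank hv
      (by rw [Module.finrank_fintype_fun_eq_card]; omega)
    intro y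
    obtain ⟨A, hA⟩ := ih _ hx (Fin.snoc (α := fun _ => κ → K) y 0)
    refine ⟨A, funext fun i => ?_⟩
    simpa [vecMulFamily] using congrFun hA i.castSucc

/-- The fibers of a surjective linear map between finite spaces have the size of its kernel. -/
theorem natCard_fiber_of_surjective {K V W : Type*} [Field K] [AddCommGroup V] [Module K V]
    [FiniteDimensional K V] [AddCommGroup W] [Module K W] (f : V →ₗ[K] W)
    (hf : Function.Surjective f) (y : W) :
    Nat.card {x // f x = y} = Nat.card K ^ (finrank K V - finrank K W) := by
  obtain ⟨x₀, rfl⟩ := hf y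
  have e : {x // f x = f x₀} ≃ LinearMap.ker f :=
    { toFun := fun x => ⟨x - x₀, by simp [x.2]⟩
      invFun := fun x => ⟨x + x₀, by simp⟩
      left_inv := fun x => by simp
      right_inv := fun x => by simp }
  have h := f.finrank_range_add_finrank_ker
  rw [LinearMap.range_eq_top.2 hf, finrank_top] at h
  rw [Nat.card_congr e, Module.natCard_eq_pow_finrank (K := K), ← h, Nat.add_sub_cancel_left]

/-- The last `n - k` coordinates of a vector of `F^n`. -/
def projRest (n k : ℕ) (v : Fin n → F) : Fin (n - k) → F :=
  fun j => v ⟨(j : ℕ) + k, by omega⟩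

theorem mem_liftSubspace_iff {K : Type} [Field K] {n k : ℕ} (hkn : k ≤ n)
    (A : Matrix (Fin k) (Fin (n - k)) K) (w : Fin n → K) :
    w ∈ liftSubspace K n k A ↔ projK K n k w ᵥ* A = projRest K n k w := by
  have hrange : liftSubspace K n k A = LinearMap.range (liftMatrix K n k A).vecMulLinear := by
    rw [_root_.range_vecMulLinear]
    rfl
  have hleft : ∀ (c : Fin k → K) (j : Fin n) (h : (j : ℕ) < k),
      (c ᵥ* liftMatrix K n k A) j = c ⟨j, h⟩ := by
    intro c j h
    rw [Matrix.vecMul, dotProduct, Finset.sum_eq_single ⟨j, h⟩]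
    · simp [liftMatrix, h]
    · intro b _ hb
      have : (b : ℕ) ≠ j := fun h' => hb (Fin.ext h')
      simp [liftMatrix, h, this]
    · simp
  have hright : ∀ (c : Fin k → K) (j : Fin n) (h : ¬ (j : ℕ) < k),
      (c ᵥ* liftMatrix K n k A) j = (c ᵥ* A) ⟨(j : ℕ) - k, by omega⟩ := by
    intro c j h
    simp [Matrix.vecMul, dotProduct, liftMatrix, h]
  rw [hrange, LinearMap.mem_range]
  constructor
  · rintro ⟨c, rfl⟩
    have hc : projK K n k (c ᵥ* liftMatrix K n k A) = c := by
      ext i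
      have hi : (i : ℕ) < n := by omega
      simp [projK, hi, hleft c ⟨i, hi⟩ i.2]
    rw [Matrix.vecMulLinear_apply, hc]
    ext j
    rw [projRest, hright _ _ (by simp)]
    simp
  · intro h
    refine ⟨projK K n k w, funext fun j => ?_⟩
    rw [Matrix.vecMulLinear_apply]
    by_cases hj : (j : ℕ) < k
    · simp [hleft _ _ hj, projK]
    · rw [hright _ _ hj, h, projRest]
      congr 1
      ext
      simp
      omega

theorem liftSubspace_injective {K : Type} [Field K] {n k : ℕ} (hkn : k ≤ n) :
    Function.Injective (liftSubspace K n k) := by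
  intro A B h
  have hproj : ∀ (c : Fin k → K) (d : Fin (n - k) → K), ∃ w : Fin n → K,
      projK K n k w = c ∧ projRest K n k w = d := by
    intro c d
    refine ⟨fun j => if h : (j : ℕ) < k then c ⟨j, h⟩ else d ⟨(j : ℕ) - k, by omega⟩, ?_, ?_⟩
    · ext i
      have hi : (i : ℕ) < n := by omega
      simp [projK, hi]
    · ext j
      simp [projRest]
  have hAB : ∀ c : Fin k → K, c ᵥ* A = c ᵥ* B := by
    intro c
    obtain ⟨w, rfl, hw⟩ := hproj c (c ᵥ* A)
    have hmem := (mem_liftSubspace_iff hkn A w).2 hw.symm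
    rw [h, mem_liftSubspace_iff hkn, hw] at hmem
    exact hmem.symm
  ext i j
  simpa using congrFun (hAB (Pi.single i 1)) j

/-- Vectors spanning distinct lines are linearly independent. -/
theorem linearIndependent_pair_of_span_ne {K V : Type*} [Field K] [AddCommGroup V] [Module K V]
    {x y : V} (hx : x ≠ 0) (hy : y ≠ 0)
    (h : Submodule.span K {x} ≠ Submodule.span K {y}) : LinearIndependent K ![x, y] := by
  rw [LinearIndependent.pair_iff' hx]
  rintro a rfl
  have ha : a ≠ 0 := by
    rintro rfl
    simp at hy
  exact h (Submodule.span_singleton_smul_eq (IsUnit.mk0 a ha) x).symm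

/-- For distinct one-dimensional subspaces `A ≠ B` of `F^k` and
`X₁ ∈ V_A^{(n,k)}`, `X₂ ∈ V_B^{(n,k)}`, the subspaces `X₁` and `X₂` are simultaneously
contained in exactly `q^{(n-k)(k-δ-1)}` codewords of the lifted MRD code. -/
theorem stmt6 (q n k δ : ℕ) (hq : Fintype.card F = q)
    (hk : 1 < k) (hkn : k ≤ n - k) (hδ1 : 1 ≤ δ) (hδk : δ ≤ k - 1)
    (C : Submodule F (Matrix (Fin k) (Fin (n - k)) F)) (hC : IsMRD F n k δ C)
    (A B : Submodule F (Fin k → F)) (hA : finrank F A = 1) (hB : finrank F B = 1) (hAB : A ≠ B)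
    (X₁ X₂ : Submodule F (Fin n → F)) (hX₁ : X₁ ∈ VA F n k A) (hX₂ : X₂ ∈ VA F n k B) :
    {Y ∈ liftedCode F n k C | X₁ ≤ Y ∧ X₂ ≤ Y}.ncard = q ^ ((n - k) * (k - δ - 1)) := by
  subst hq
  obtain ⟨v, hv, rfl, rfl⟩ := hX₁
  obtain ⟨w, hw, rfl, rfl⟩ := hX₂
  have hkn' : k ≤ n := by omega
  have hdim : finrank F C = Fintype.card (Fin (n - k)) * (k - δ + 1) := by simpa using hC.1
  have hsurj := vecMulFamily_surjective (by simp; omega) (by simp; omega) hdim hC.2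
    (show 2 ≤ k - δ + 1 by omega) _ (linearIndependent_pair_of_span_ne hv hw hAB)
  have hset : {Y ∈ liftedCode F n k C |
      Submodule.span F {v} ≤ Y ∧ Submodule.span F {w} ≤ Y} =
      (liftSubspace F n k ∘ Subtype.val) '' {A | vecMulFamily C
        ![projK F n k v, projK F n k w] A = ![projRest F n k v, projRest F n k w]} := by
    have key : ∀ A : C, vecMulFamily C ![projK F n k v, projK F n k w] A =
        ![projRest F n k v, projRest F n k w] ↔
        v ∈ liftSubspace F n k A ∧ w ∈ liftSubspace F n k A := by
      intro A
      simp [mem_liftSubspace_iff hkn', vecMulFamily, funext_iff, Fin.forall_fin_two]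
    ext Y
    simp only [Set.mem_ofPred_eq, Set.mem_image, key, Submodule.span_singleton_le_iff_mem]
    constructor
    · rintro ⟨⟨A, hA, rfl⟩, h⟩
      exact ⟨⟨A, hA⟩, h, rfl⟩
    · rintro ⟨A, h, rfl⟩
      exact ⟨⟨A, A.2, rfl⟩, h⟩
  rw [hset, Set.ncard_image_of_injective _
    ((liftSubspace_injective hkn').comp Subtype.val_injective), ← Nat.card_coe_set_eq]
  refine (natCard_fiber_of_surjective _ hsurj _).trans ?_
  rw [Nat.card_eq_fintype_card, hC.1]
  congr 1
  simp only [Module.finrank_pi_fintype, Module.finrank_self, Finset.sum_const, Finset.card_univ,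
    Fintype.card_fin, smul_eq_mul, mul_one]
  rw [mul_comm 2, ← Nat.mul_sub]
  congr 1
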